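/- arXiv:0903.4597 — 3 statements merged into one kernel-verified Lean document; each statement's English description precedes it below -/
import Mathlib

section
/- Let n ≥ 1 and 0 ≤ l ≤ k. The map (g, (q_0,…,q_n)) ↦ (g·q_0, …, g·q_n) is a homeomorphism from {monic polynomials of degree l over ℂ} × R_{k−l,n} onto the subspace of (n+1)-tuples of monic degree-k complex polynomials whose gcd in ℂ[z] has degree exactly l. In particular, as sets, X_{k,n}^{l} − X_{k,n}^{l−1} ≅ ℂ^{l} × R_{k−l,n}. -/
open Polynomial

/-- The monic real polynomial of degree `k` with lower-order coefficient vector `c`. -/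
noncomputable def toPolyR (k : ℕ) (c : Fin k → ℝ) : Polynomial ℝ :=
  Polynomial.X ^ k + ∑ i : Fin k, Polynomial.C (c i) * Polynomial.X ^ (i : ℕ)

/-- The monic complex polynomial of degree `k` with lower-order coefficient vector `c`. -/
noncomputable def toPolyC (k : ℕ) (c : Fin k → ℂ) : Polynomial ℂ :=
  Polynomial.X ^ k + ∑ i : Fin k, Polynomial.C (c i) * Polynomial.X ^ (i : ℕ)

/-- `RX_{k,n}^l`: tuples of monic real degree-`k` polynomials with gcd of degree `≤ l`,
as a subset of `ℝ^{k(n+1)}` via coefficient vectors. -/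
def RXset (k n l : ℕ) : Set (Fin (n + 1) → Fin k → ℝ) :=
  {f | (Finset.univ.gcd fun j => toPolyR k (f j)).natDegree ≤ l}

/-- `X_{k,n}^l`: tuples of monic complex degree-`k` polynomials with gcd of degree `≤ l`. -/
def Xset (k n l : ℕ) : Set (Fin (n + 1) → Fin k → ℂ) :=
  {f | (Finset.univ.gcd fun j => toPolyC k (f j)).natDegree ≤ l}

/-- `Y_{k,n}^l`: elements of `RX_{k,n}^l` with no common real root. -/
def Yset (k n l : ℕ) : Set (Fin (n + 1) → Fin k → ℝ) :=
  {f | f ∈ RXset k n l ∧ ∀ x : ℝ, ∃ j, (toPolyR k (f j)).eval x ≠ 0}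

theorem toPolyC_coeff (k : ℕ) (c : Fin k → ℂ) (m : ℕ) :
    (toPolyC k c).coeff m =
      (if m = k then 1 else 0) + ∑ i : Fin k, if m = (i : ℕ) then c i else 0 := by
  simp [toPolyC, coeff_X_pow]

theorem toPolyC_coeff_fin (k : ℕ) (c : Fin k → ℂ) (i : Fin k) : (toPolyC k c).coeff i = c i := by
  simp [toPolyC_coeff, i.2.ne, Fin.val_inj]

theorem toPolyC_injective (k : ℕ) : Function.Injective (toPolyC k) := fun c d h => by
  ext i
  rw [← toPolyC_coeff_fin k c, h, toPolyC_coeff_fin]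

theorem degree_toPolyC_lower_lt (k : ℕ) (c : Fin k → ℂ) :
    (∑ i : Fin k, C (c i) * X ^ (i : ℕ)).degree < (k : WithBot ℕ) := by
  refine (degree_sum_le _ _).trans_lt ((Finset.sup_lt_iff (WithBot.bot_lt_coe k)).2 fun i _ => ?_)
  exact (degree_C_mul_X_pow_le _ _).trans_lt (WithBot.coe_lt_coe.2 i.2)

theorem monic_toPolyC (k : ℕ) (c : Fin k → ℂ) : (toPolyC k c).Monic :=
  monic_X_pow_add (degree_toPolyC_lower_lt k c)

theorem natDegree_toPolyC (k : ℕ) (c : Fin k → ℂ) : (toPolyC k c).natDegree = k :=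
  natDegree_eq_of_degree_eq_some (by
    rw [toPolyC, degree_add_eq_left_of_degree_lt] <;> rw [degree_X_pow]
    exact degree_toPolyC_lower_lt k c)

theorem toPolyC_of_monic {k : ℕ} {p : ℂ[X]} (hp : p.Monic) (hk : p.natDegree = k) :
    toPolyC k (fun i => p.coeff i) = p := by
  conv_rhs => rw [hp.as_sum, hk]
  rw [toPolyC, ← Fin.sum_univ_eq_sum_range fun i => C (p.coeff i) * X ^ i]

/-- A monic divisor of a monic complex polynomial has coefficients bounded in terms of the
coefficients of that polynomial. -/
theorem norm_coeff_le_of_dvd_toPolyC {k : ℕ} {c : Fin k → ℂ} {B : ℝ} (hB : ‖c‖ ≤ B)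
    {p : ℂ[X]} (hp : p.Monic) (hpc : p ∣ toPolyC k c) (i : ℕ) :
    ‖p.coeff i‖ ≤ max (B + 1) 1 ^ k * k.choose (k / 2) := by
  have hc := monic_toPolyC k c
  have hdeg : p.natDegree ≤ k :=
    (natDegree_le_of_dvd hpc hc.ne_zero).trans_eq (natDegree_toPolyC k c)
  have hbound : ((toPolyC k c).cauchyBound : ℝ) ≤ B + 1 := by
    lift B to NNReal using (norm_nonneg c).trans hB
    rw [cauchyBound, hc.leadingCoeff, nnnorm_one, div_one]
    norm_cast
    gcongr
    refine Finset.sup_le fun m hm => ?_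
    rw [Finset.mem_range, natDegree_toPolyC] at hm
    rw [toPolyC_coeff_fin k c ⟨m, hm⟩]
    exact (nnnorm_le_pi_nnnorm c _).trans hB
  have h := coeff_bdd_of_roots_le (RingHom.id ℂ) (B := B + 1) hp
    (IsAlgClosed.splits _) hdeg (fun z hz => ?_) i
  · simpa using h
  · rw [Polynomial.map_id] at hz
    have hroot : (toPolyC k c).IsRoot z := (isRoot_of_mem_roots hz).dvd hpc
    have hlt := hroot.norm_lt_cauchyBound hc.ne_zero
    exact (NNReal.coe_lt_coe.2 hlt).le.trans hbound

/-- Coefficients of the products of a monic polynomial with a tuple of monic polynomials. -/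
noncomputable def mulTuple (ι : Type*) (k l m : ℕ) (x : (Fin l → ℂ) × (ι → Fin m → ℂ)) :
    ι → Fin k → ℂ :=
  fun j i => (toPolyC l x.1 * toPolyC m (x.2 j)).coeff i

theorem toPolyC_mulTuple {ι : Type*} {k l m : ℕ} (hk : l + m = k)
    (x : (Fin l → ℂ) × (ι → Fin m → ℂ)) (j : ι) :
    toPolyC k (mulTuple ι k l m x j) = toPolyC l x.1 * toPolyC m (x.2 j) :=
  toPolyC_of_monic ((monic_toPolyC _ _).mul (monic_toPolyC _ _)) (by
    rw [(monic_toPolyC _ _).natDegree_mul (monic_toPolyC _ _), natDegree_toPolyC,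
      natDegree_toPolyC, hk])

theorem continuous_mulTuple (ι : Type*) (k l m : ℕ) : Continuous (mulTuple ι k l m) := by
  refine continuous_pi fun j => continuous_pi fun i => ?_
  simp only [mulTuple, coeff_mul, toPolyC_coeff]
  refine continuous_finsetSum _ fun a _ => Continuous.mul ?_ ?_ <;>
  · refine continuous_const.add (continuous_finsetSum _ fun b _ => ?_)
    split_ifs <;> fun_prop

theorem isProperMap_mulTuple {ι : Type*} [Fintype ι] [Nonempty ι] {k l m : ℕ} (hk : l + m = k) :
    IsProperMap (mulTuple ι k l m) := by
  have hcont := continuous_mulTuple ι k l m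
  refine isProperMap_iff_isCompact_preimage.2 ⟨hcont, fun K hK => ?_⟩
  obtain ⟨B, hB⟩ := hK.isBounded.exists_norm_le
  refine Metric.isCompact_of_isClosed_isBounded (hK.isClosed.preimage hcont)
    (isBounded_iff_forall_norm_le.2 ⟨max (B + 1) 1 ^ k * k.choose (k / 2), fun x hx => ?_⟩)
  have hx' (j : ι) : ‖mulTuple ι k l m x j‖ ≤ B := (norm_le_pi_norm _ j).trans (hB _ hx)
  have h0 : 0 ≤ max (B + 1) 1 ^ k * (k.choose (k / 2) : ℝ) := by positivity
  refine norm_prod_le_iff.2 ⟨(pi_norm_le_iff_of_nonneg h0).2 fun i => ?_,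
    (pi_norm_le_iff_of_nonneg h0).2 fun j => (pi_norm_le_iff_of_nonneg h0).2 fun i => ?_⟩
  · rw [← toPolyC_coeff_fin l x.1]
    refine norm_coeff_le_of_dvd_toPolyC (hx' (Classical.arbitrary ι)) (monic_toPolyC _ _) ?_ i
    exact toPolyC_mulTuple hk x _ ▸ dvd_mul_right _ _
  · rw [← toPolyC_coeff_fin m (x.2 j)]
    refine norm_coeff_le_of_dvd_toPolyC (hx' j) (monic_toPolyC _ _) ?_ i
    exact toPolyC_mulTuple hk x _ ▸ dvd_mul_left _ _

theorem gcd_toPolyC_ne_zero {ι : Type*} [Fintype ι] [Nonempty ι] {k : ℕ} (f : ι → Fin k → ℂ) :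
    (Finset.univ.gcd fun j => toPolyC k (f j)) ≠ 0 := fun h =>
  (monic_toPolyC k (f (Classical.arbitrary ι))).ne_zero
    (Finset.gcd_eq_zero_iff.1 h _ (Finset.mem_univ _))

theorem monic_gcd_toPolyC {ι : Type*} [Fintype ι] [Nonempty ι] {k : ℕ} (f : ι → Fin k → ℂ) :
    (Finset.univ.gcd fun j => toPolyC k (f j)).Monic := by
  rw [← Finset.normalize_gcd]
  exact monic_normalize (gcd_toPolyC_ne_zero f)

theorem gcd_mulTuple {ι : Type*} [Fintype ι] [Nonempty ι] {k l m : ℕ} (hk : l + m = k)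
    (x : (Fin l → ℂ) × (ι → Fin m → ℂ)) :
    (Finset.univ.gcd fun j => toPolyC k (mulTuple ι k l m x j)) =
      toPolyC l x.1 * Finset.univ.gcd fun j => toPolyC m (x.2 j) := by
  refine eq_of_monic_of_associated (monic_gcd_toPolyC _)
    ((monic_toPolyC _ _).mul (monic_gcd_toPolyC _)) ?_
  simp only [toPolyC_mulTuple hk]
  exact Finset.gcd_mul_left' _ _ _

theorem natDegree_gcd_mulTuple {ι : Type*} [Fintype ι] [Nonempty ι] {k l m : ℕ} (hk : l + m = k)
    (x : (Fin l → ℂ) × (ι → Fin m → ℂ)) :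
    (Finset.univ.gcd fun j => toPolyC k (mulTuple ι k l m x j)).natDegree =
      l + (Finset.univ.gcd fun j => toPolyC m (x.2 j)).natDegree := by
  rw [gcd_mulTuple hk, (monic_toPolyC _ _).natDegree_mul (monic_gcd_toPolyC _), natDegree_toPolyC]

theorem mulTuple_injOn {ι : Type*} [Fintype ι] [Nonempty ι] {k l m : ℕ} (hk : l + m = k) :
    Set.InjOn (mulTuple ι k l m)
      {x | (Finset.univ.gcd fun j => toPolyC m (x.2 j)).natDegree = 0} := by
  intro x hx y hy hxy
  have hgcd (z : (Fin l → ℂ) × (ι → Fin m → ℂ))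
      (hz : (Finset.univ.gcd fun j => toPolyC m (z.2 j)).natDegree = 0) :
      (Finset.univ.gcd fun j => toPolyC k (mulTuple ι k l m z j)) = toPolyC l z.1 := by
    rw [gcd_mulTuple hk, (monic_gcd_toPolyC _).natDegree_eq_zero.1 hz, mul_one]
  have h1 : toPolyC l x.1 = toPolyC l y.1 := by rw [← hgcd x hx, hxy, hgcd y hy]
  refine Prod.ext (toPolyC_injective l h1) (funext fun j => toPolyC_injective m ?_)
  refine mul_left_cancel₀ (monic_toPolyC l x.1).ne_zero ?_
  rw [← toPolyC_mulTuple hk, hxy, toPolyC_mulTuple hk, h1]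

theorem exists_mulTuple_eq {ι : Type*} [Fintype ι] [Nonempty ι] {k l m : ℕ} (hk : l + m = k)
    (f : ι → Fin k → ℂ) (hf : (Finset.univ.gcd fun j => toPolyC k (f j)).natDegree = l) :
    ∃ x, mulTuple ι k l m x = f := by
  have hd := monic_gcd_toPolyC f
  choose h hh using fun j =>
    Finset.gcd_dvd (f := fun j => toPolyC k (f j)) (Finset.mem_univ j)
  have hmonic (j : ι) : (h j).Monic := hd.of_mul_monic_left (hh j ▸ monic_toPolyC k (f j))
  have hdeg (j : ι) : (h j).natDegree = m := by
    have := congrArg natDegree (hh j)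
    rw [hd.natDegree_mul (hmonic j), hf, natDegree_toPolyC] at this
    omega
  refine ⟨(fun i => (Finset.univ.gcd fun j => toPolyC k (f j)).coeff i,
    fun j i => (h j).coeff i), funext fun j => toPolyC_injective k ?_⟩
  rw [toPolyC_mulTuple hk, toPolyC_of_monic hd hf, toPolyC_of_monic (hmonic j) (hdeg j)]
  exact (hh j).symm

/-- The stratum `X_{k,n}^{l} − X_{k,n}^{l−1}` of tuples whose gcd has degree exactly `l` is
homeomorphic to `ℂ^l × R_{k−l,n}` via `(g, (q_0,…,q_n)) ↦ (g·q_0, …, g·q_n)`, where `ℂ^l` is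
identified with the monic complex polynomials of degree `l`. -/
theorem stratum_homeo_complex (n k l : ℕ) (hn : 1 ≤ n) (hl : l ≤ k) :
    ∃ H : ((Fin l → ℂ) × ↥(Xset (k - l) n 0)) ≃ₜ
        ↥{f : Fin (n + 1) → Fin k → ℂ |
            (Finset.univ.gcd fun j => toPolyC k (f j)).natDegree = l},
      ∀ (g : Fin l → ℂ) (q : ↥(Xset (k - l) n 0)) (j : Fin (n + 1)) (i : Fin k),
        (H (g, q)).val j i = (toPolyC l g * toPolyC (k - l) (q.val j)).coeff i := by
  have hk : l + (k - l) = k := Nat.add_sub_cancel' hl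
  let S : Set (Fin (n + 1) → Fin k → ℂ) :=
    {f | (Finset.univ.gcd fun j => toPolyC k (f j)).natDegree = l}
  let Φ := mulTuple (Fin (n + 1)) k l (k - l)
  have hmem (x : (Fin l → ℂ) × (Fin (n + 1) → Fin (k - l) → ℂ)) :
      Φ x ∈ S ↔ x.2 ∈ Xset (k - l) n 0 := by
    change Polynomial.natDegree _ = l ↔ Polynomial.natDegree _ ≤ 0
    rw [natDegree_gcd_mulTuple hk]
    omega
  let e : ((Fin l → ℂ) × ↥(Xset (k - l) n 0)) ≃ₜ ↥(Φ ⁻¹' S) :=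
    { toFun := fun x => ⟨(x.1, x.2.val), (hmem _).2 x.2.2⟩
      invFun := fun x => (x.val.1, ⟨x.val.2, (hmem _).1 x.2⟩)
      left_inv := fun _ => rfl
      right_inv := fun _ => rfl
      continuous_toFun := by fun_prop
      continuous_invFun := by fun_prop }
  have hproper := (isProperMap_mulTuple (ι := Fin (n + 1)) hk).restrictPreimage S
  have hΦ : IsHomeomorph (S.restrictPreimage Φ) := by
    refine isHomeomorph_iff_continuous_isClosedMap_bijective.2
      ⟨hproper.continuous, hproper.isClosedMap, fun x y hxy => ?_, fun f => ?_⟩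
    · exact Subtype.ext (mulTuple_injOn hk (Nat.le_zero.1 ((hmem _).1 x.2))
        (Nat.le_zero.1 ((hmem _).1 y.2)) (congrArg Subtype.val hxy))
    · obtain ⟨x, hx⟩ := exists_mulTuple_eq hk f.1 f.2
      exact ⟨⟨x, (congrArg (· ∈ S) hx).mpr f.2⟩, Subtype.ext hx⟩
  exact ⟨e.trans hΦ.homeomorph, fun _ _ _ _ => rfl⟩
end

section
/- Let q ≥ 1, n ≥ 1, i ≥ 0, and let h : ℂ → H₊ be an injective map into the open upper half-plane H₊ = {z ∈ ℂ : Im z > 0}. Given monic polynomials p_0,…,p_n over ℂ of degree q, for each j let P_j = ∏_{α} (z − h(α))(z − conj(h(α))), the product taken over the multiset of roots α of p_j (with multiplicity). Then: (1) each P_j is a monic polynomial of degree 2q all of whose coefficients are real (i.e. P_j lies in the image of ℝ[z] → ℂ[z]); (2) the polynomials P_0,…,P_n have no common real root; and (3) the degree of gcd(P_0,…,P_n) equals twice the degree of gcd(p_0,…,p_n). In particular, the map η sending (p_0,…,p_n) to (P_0,…,P_n) carries X_{q,n}^{i} into Y_{2q,n}^{2i}, and it is injective. (Well-definedness of the inclusion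 η_{q,i,n} of display (3.2) of the paper.) -/
open Polynomial

/-- The polynomial `∏_α (z − h(α))(z − conj(h(α)))`, product over the multiset of roots of `p`. -/
noncomputable def etaPoly (h : ℂ → ℂ) (p : Polynomial ℂ) : Polynomial ℂ :=
  (p.roots.map fun α =>
    (Polynomial.X - Polynomial.C (h α)) *
      (Polynomial.X - Polynomial.C (starRingEnd ℂ (h α)))).prod

section EtaPoly

variable {h : ℂ → ℂ}

lemma etaPoly_monic (h : ℂ → ℂ) (p : ℂ[X]) : (etaPoly h p).Monic :=
  monic_multiset_prod_of_monic _ _ fun _ _ => (monic_X_sub_C _).mul (monic_X_sub_C _)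

lemma roots_etaPoly (h : ℂ → ℂ) (p : ℂ[X]) :
    (etaPoly h p).roots =
      p.roots.map h + p.roots.map fun α => starRingEnd ℂ (h α) := by
  have key : etaPoly h p =
      ((p.roots.map h + p.roots.map fun α => starRingEnd ℂ (h α)).map fun a => X - C a).prod := by
    simp [etaPoly, Multiset.prod_map_mul, Multiset.map_map]
  rw [key, roots_multiset_prod_X_sub_C]

lemma natDegree_etaPoly (h : ℂ → ℂ) (p : ℂ[X]) :
    (etaPoly h p).natDegree = 2 * p.natDegree := by
  rw [(IsAlgClosed.splits (etaPoly h p)).natDegree_eq_card_roots, roots_etaPoly,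
    (IsAlgClosed.splits p).natDegree_eq_card_roots]
  simp [two_mul]

lemma etaPoly_eq_map_ofReal (h : ℂ → ℂ) (p : ℂ[X]) :
    ∃ Q : ℝ[X], etaPoly h p = Q.map Complex.ofRealHom := by
  refine ⟨(p.roots.map fun α => X ^ 2 - C (2 * (h α).re) * X + C (Complex.normSq (h α))).prod, ?_⟩
  rw [Polynomial.map_multiset_prod, Multiset.map_map, etaPoly]
  congr 1
  refine Multiset.map_congr rfl fun α _ => ?_
  have hadd : C (((2 * (h α).re : ℝ) : ℂ)) = C (h α) + C (starRingEnd ℂ (h α)) := by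
    rw [← C_add, Complex.add_conj]
  have hmul : C ((Complex.normSq (h α) : ℂ)) = C (h α) * C (starRingEnd ℂ (h α)) := by
    rw [← C_mul, Complex.mul_conj]
  simp only [Function.comp_apply, Polynomial.map_add, Polynomial.map_sub, Polynomial.map_mul,
    Polynomial.map_pow, map_X, map_C, Complex.ofRealHom_eq_coe, hadd, hmul]
  ring

lemma etaPoly_eval_ofReal_ne_zero (hupper : ∀ z, 0 < (h z).im) (p : ℂ[X]) (x : ℝ) :
    (etaPoly h p).eval (x : ℂ) ≠ 0 := by
  intro hx
  have hmem : (x : ℂ) ∈ (etaPoly h p).roots := (mem_roots (etaPoly_monic h p).ne_zero).2 hx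
  rw [roots_etaPoly, Multiset.mem_add, Multiset.mem_map, Multiset.mem_map] at hmem
  obtain ⟨α, -, hα⟩ | ⟨α, -, hα⟩ := hmem <;>
  · have him := congrArg Complex.im hα
    have := hupper α
    simp at him
    linarith

lemma count_roots_etaPoly_apply (hinj : Function.Injective h) (hupper : ∀ z, 0 < (h z).im)
    (p : ℂ[X]) (α : ℂ) : (etaPoly h p).roots.count (h α) = p.roots.count α := by
  rw [roots_etaPoly, Multiset.count_add, Multiset.count_map_eq_count' h _ hinj,
    Nat.add_eq_left, Multiset.count_eq_zero]
  rw [Multiset.mem_map]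
  rintro ⟨β, -, hβ⟩
  have him := congrArg Complex.im hβ
  rw [Complex.conj_im] at him
  linarith [hupper α, hupper β]

lemma count_roots_etaPoly_conj_apply (hinj : Function.Injective h) (hupper : ∀ z, 0 < (h z).im)
    (p : ℂ[X]) (α : ℂ) :
    (etaPoly h p).roots.count (starRingEnd ℂ (h α)) = p.roots.count α := by
  have hinj' : Function.Injective fun α => starRingEnd ℂ (h α) :=
    (starRingEnd ℂ).injective.comp hinj
  rw [roots_etaPoly, Multiset.count_add, Multiset.count_eq_zero_of_notMem, zero_add]
  · exact Multiset.count_map_eq_count' (fun α => starRingEnd ℂ (h α)) _ hinj' α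
  rw [Multiset.mem_map]
  rintro ⟨β, -, hβ⟩
  have him := congrArg Complex.im hβ
  rw [Complex.conj_im] at him
  linarith [hupper α, hupper β]

lemma etaPoly_dvd_etaPoly {p r : ℂ[X]} (hr : r ≠ 0) (hpr : p ∣ r) :
    etaPoly h p ∣ etaPoly h r :=
  Multiset.prod_dvd_prod_of_le (Multiset.map_le_map (roots.le_of_dvd hr hpr))

lemma exists_count_roots_le_count_roots_gcd {ι : Type*} [Fintype ι] (p : ι → ℂ[X])
    (hne : Finset.univ.gcd p ≠ 0) (α : ℂ) :
    ∃ j, (p j).roots.count α ≤ (Finset.univ.gcd p).roots.count α := by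
  by_contra! hlt
  have hdvd : (X - C α) ^ ((Finset.univ.gcd p).roots.count α + 1) ∣ Finset.univ.gcd p := by
    refine Finset.dvd_gcd fun j _ => ?_
    have hj := hlt j
    rw [count_roots (p j)] at hj
    exact (pow_dvd_pow _ hj).trans (pow_rootMultiplicity_dvd _ _)
  rw [← le_rootMultiplicity_iff hne, count_roots] at hdvd
  omega

lemma gcd_etaPoly_dvd {ι : Type*} [Fintype ι] [Nonempty ι] (hinj : Function.Injective h)
    (hupper : ∀ z, 0 < (h z).im) (p : ι → ℂ[X]) (hne : Finset.univ.gcd p ≠ 0) :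
    (Finset.univ.gcd fun j => etaPoly h (p j)) ∣ etaPoly h (Finset.univ.gcd p) := by
  have hdvd (j : ι) : (Finset.univ.gcd fun j => etaPoly h (p j)) ∣ etaPoly h (p j) :=
    Finset.gcd_dvd (Finset.mem_univ j)
  have hle (j : ι) (w : ℂ) : (Finset.univ.gcd fun j => etaPoly h (p j)).roots.count w ≤
      (etaPoly h (p j)).roots.count w :=
    Multiset.count_le_of_le w (roots.le_of_dvd (etaPoly_monic h (p j)).ne_zero (hdvd j))
  have hD : (Finset.univ.gcd fun j => etaPoly h (p j)) ≠ 0 :=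
    ne_zero_of_dvd_ne_zero (etaPoly_monic h _).ne_zero (hdvd (Classical.arbitrary ι))
  rw [(IsAlgClosed.splits _).dvd_iff_roots_le_roots hD (etaPoly_monic h _).ne_zero,
    Multiset.le_iff_count]
  intro w
  by_cases hw : w ∈ (Finset.univ.gcd fun j => etaPoly h (p j)).roots
  · have hmem := Multiset.mem_of_le
      (roots.le_of_dvd (etaPoly_monic h _).ne_zero (hdvd (Classical.arbitrary ι))) hw
    rw [roots_etaPoly, Multiset.mem_add, Multiset.mem_map, Multiset.mem_map] at hmem
    obtain ⟨α, -, rfl⟩ | ⟨α, -, rfl⟩ := hmem <;>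
      obtain ⟨j, hj⟩ := exists_count_roots_le_count_roots_gcd p hne α <;>
      refine (hle j _).trans ?_
    · rwa [count_roots_etaPoly_apply hinj hupper, count_roots_etaPoly_apply hinj hupper]
    · rwa [count_roots_etaPoly_conj_apply hinj hupper, count_roots_etaPoly_conj_apply hinj hupper]
  · simp [Multiset.count_eq_zero_of_notMem hw]

lemma natDegree_gcd_etaPoly {ι : Type*} [Fintype ι] [Nonempty ι] (hinj : Function.Injective h)
    (hupper : ∀ z, 0 < (h z).im) (p : ι → ℂ[X]) (hp : ∀ j, p j ≠ 0) :
    (Finset.univ.gcd fun j => etaPoly h (p j)).natDegree = 2 * (Finset.univ.gcd p).natDegree := by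
  have hg (j : ι) : Finset.univ.gcd p ∣ p j := Finset.gcd_dvd (Finset.mem_univ j)
  have hne : Finset.univ.gcd p ≠ 0 :=
    ne_zero_of_dvd_ne_zero (hp (Classical.arbitrary ι)) (hg _)
  rw [← natDegree_etaPoly h]
  exact natDegree_eq_of_degree_eq (degree_eq_degree_of_associated (associated_of_dvd_dvd
    (gcd_etaPoly_dvd hinj hupper p hne)
    (Finset.dvd_gcd fun j _ => etaPoly_dvd_etaPoly (hp j) (hg j))))

lemma etaPoly_inj_of_monic (hinj : Function.Injective h) (hupper : ∀ z, 0 < (h z).im)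
    {p r : ℂ[X]} (hp : p.Monic) (hr : r.Monic) (heq : etaPoly h p = etaPoly h r) : p = r := by
  have hroots : p.roots = r.roots := by
    ext α
    rw [← count_roots_etaPoly_apply hinj hupper, heq, count_roots_etaPoly_apply hinj hupper]
  rw [(IsAlgClosed.splits p).eq_prod_roots_of_monic hp,
    (IsAlgClosed.splits r).eq_prod_roots_of_monic hr, hroots]

end EtaPoly

/-- **Well-definedness of `η_{q,i,n}` (display (3.2)).** For an injective `h : ℂ → H₊` and monic
degree-`q` polynomials `p_0,…,p_n`, the polynomials `P_j = ∏_α (z − h(α))(z − conj h(α))`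
(product over the roots of `p_j` with multiplicity) are monic of degree `2q` with real
coefficients, have no common real root, and `deg gcd(P_0,…,P_n) = 2 · deg gcd(p_0,…,p_n)`;
moreover the assignment `(p_0,…,p_n) ↦ (P_0,…,P_n)` is injective on tuples of monic degree-`q`
polynomials. In particular `η` carries `X_{q,n}^{i}` into `Y_{2q,n}^{2i}` injectively. -/
theorem eta_well_defined (q n i : ℕ) (hq : 1 ≤ q) (hn : 1 ≤ n)
    (h : ℂ → ℂ) (hinj : Function.Injective h) (hupper : ∀ z : ℂ, 0 < (h z).im)
    (p : Fin (n + 1) → Polynomial ℂ) (hmonic : ∀ j, (p j).Monic)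
    (hdeg : ∀ j, (p j).natDegree = q) :
    (∀ j, (etaPoly h (p j)).Monic ∧ (etaPoly h (p j)).natDegree = 2 * q ∧
        ∃ Q : Polynomial ℝ, etaPoly h (p j) = Q.map Complex.ofRealHom) ∧
    (∀ x : ℝ, ∃ j, (etaPoly h (p j)).eval (x : ℂ) ≠ 0) ∧
    (Finset.univ.gcd fun j => etaPoly h (p j)).natDegree =
      2 * (Finset.univ.gcd p).natDegree ∧
    (∀ p' : Fin (n + 1) → Polynomial ℂ, (∀ j, (p' j).Monic) → (∀ j, (p' j).natDegree = q) →
      (∀ j, etaPoly h (p j) = etaPoly h (p' j)) → p = p') := by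
  refine ⟨fun j => ⟨etaPoly_monic h _, by rw [natDegree_etaPoly, hdeg], etaPoly_eq_map_ofReal h _⟩,
    fun x => ⟨0, etaPoly_eval_ofReal_ne_zero hupper _ x⟩,
    natDegree_gcd_etaPoly hinj hupper p fun j => (hmonic j).ne_zero, ?_⟩
  exact fun p' hmonic' _ heq =>
    funext fun j => etaPoly_inj_of_monic hinj hupper (hmonic j) (hmonic' j) (heq j)
end

section
/- For every i ≥ 1, the map sending an unordered i-tuple (α_1,…,α_i) of points of the open upper half-plane H₊ = {z ∈ ℂ : Im z > 0} to the polynomial ∏_{s=1}^{i} (z − α_s)(z − conj(α_s)) induces a homeomorphism from the i-th symmetric product SP^{i}(H₊) — the quotient of (H₊)^{i} by the permutation action of the symmetric group, with the quotient topology — onto the space of monic real polynomials of degree 2i with no real roots (topologized as a subspace of ℝ^{2i} via coefficients). -/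
open Polynomial

/-- The setoid on `T^i` identifying tuples up to permutation of coordinates; the quotient is the
`i`-th symmetric product `SP^i(T)`, carrying the quotient topology. -/
def permSetoid (T : Type*) (i : ℕ) : Setoid (Fin i → T) where
  r v w := ∃ σ : Equiv.Perm (Fin i), v ∘ σ = w
  iseqv := by
    refine ⟨fun v => ⟨Equiv.refl _, rfl⟩, ?_, ?_⟩
    · rintro v w ⟨σ, rfl⟩
      exact ⟨σ.symm, by ext s; simp⟩
    · rintro u v w ⟨σ, rfl⟩ ⟨τ, rfl⟩
      exact ⟨τ.trans σ, by ext s; simp⟩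

open Filter Topology ComplexConjugate

/-- The real quadratic polynomial with roots `z` and its conjugate. -/
noncomputable def conjQuadratic (z : ℂ) : ℝ[X] :=
  X ^ 2 - C (2 * z.re) * X + C (‖z‖ ^ 2)

lemma map_conjQuadratic (z : ℂ) :
    (conjQuadratic z).map (algebraMap ℝ ℂ) = (X - C z) * (X - C (conj z)) := by
  have h : (conjQuadratic z).map (algebraMap ℝ ℂ) =
      X ^ 2 - C (↑(2 * z.re) : ℂ) * X + C (‖z‖ ^ 2 : ℂ) := by simp [conjQuadratic]
  rw [h, ← Complex.add_conj, map_add, ← Complex.mul_conj', map_mul]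
  ring

lemma conjQuadratic_eq (z : ℂ) :
    conjQuadratic z = X ^ 2 + (C (-(2 * z.re)) * X + C (‖z‖ ^ 2)) := by
  rw [conjQuadratic, C_neg]
  ring

lemma natDegree_conjQuadratic (z : ℂ) : (conjQuadratic z).natDegree = 2 := by
  rw [conjQuadratic_eq]
  compute_degree!

lemma monic_conjQuadratic (z : ℂ) : (conjQuadratic z).Monic := by
  rw [conjQuadratic_eq]
  monicity!

lemma continuous_coeff_conjQuadratic (m : ℕ) : Continuous fun z ↦ (conjQuadratic z).coeff m := by
  simp only [conjQuadratic, coeff_add, coeff_sub, coeff_X_pow, coeff_C_mul, coeff_C, coeff_X]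
  split_ifs <;> fun_prop

/-- The real polynomial whose roots are the entries of `v` and their conjugates. -/
noncomputable def conjProd {i : ℕ} (v : Fin i → ℂ) : ℝ[X] :=
  ∏ s, conjQuadratic (v s)

lemma map_conjProd {i : ℕ} (v : Fin i → ℂ) :
    (conjProd v).map (algebraMap ℝ ℂ) = ∏ s, (X - C (v s)) * (X - C (conj (v s))) := by
  simp only [conjProd, Polynomial.map_prod, map_conjQuadratic]

lemma monic_conjProd {i : ℕ} (v : Fin i → ℂ) : (conjProd v).Monic :=
  monic_prod_of_monic _ _ fun s _ ↦ monic_conjQuadratic (v s)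

lemma natDegree_conjProd {i : ℕ} (v : Fin i → ℂ) : (conjProd v).natDegree = 2 * i := by
  rw [conjProd, natDegree_prod_of_monic _ _ fun s _ ↦ monic_conjQuadratic (v s)]
  simp [natDegree_conjQuadratic, mul_comm]

lemma conjProd_comp_perm {i : ℕ} (v : Fin i → ℂ) (σ : Equiv.Perm (Fin i)) :
    conjProd (v ∘ σ) = conjProd v :=
  Equiv.prod_comp σ fun s ↦ conjQuadratic (v s)

lemma continuous_coeff_prod {T ι : Type*} [TopologicalSpace T] (S : Finset ι) (p : ι → T → ℝ[X])
    (hp : ∀ s m, Continuous fun t ↦ (p s t).coeff m) (m : ℕ) :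
    Continuous fun t ↦ (∏ s ∈ S, p s t).coeff m := by
  classical
  induction S using Finset.induction_on generalizing m with
  | empty => simpa using continuous_const
  | insert a S ha ih =>
    simp only [Finset.prod_insert ha, coeff_mul]
    exact continuous_finsetSum _ fun x _ ↦ (hp a x.1).mul (ih x.2)

lemma coeff_toPolyR {k : ℕ} (c : Fin k → ℝ) (m : Fin k) : (toPolyR k c).coeff m = c m := by
  simp [toPolyR, coeff_X_pow, m.2.ne, Fin.val_inj]

lemma degree_toPolyR_tail_lt {k : ℕ} (c : Fin k → ℝ) :
    (∑ i : Fin k, C (c i) * X ^ (i : ℕ)).degree < (k : WithBot ℕ) :=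
  degree_sum_fin_lt c

lemma monic_toPolyR {k : ℕ} (c : Fin k → ℝ) : (toPolyR k c).Monic :=
  monic_X_pow_add (degree_toPolyR_tail_lt c)

lemma natDegree_toPolyR {k : ℕ} (c : Fin k → ℝ) : (toPolyR k c).natDegree = k := by
  apply natDegree_eq_of_degree_eq_some
  rw [toPolyR, degree_add_eq_left_of_degree_lt, degree_X_pow]
  rw [degree_X_pow]
  exact degree_toPolyR_tail_lt c

lemma toPolyR_coeff {k : ℕ} {p : ℝ[X]} (hp : p.Monic) (hk : p.natDegree = k) :
    toPolyR k (fun m ↦ p.coeff m) = p := by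
  subst hk
  conv_rhs => rw [hp.as_sum]
  rw [toPolyR, Finset.sum_range]

/-- The lower-order coefficients of `conjProd v`. -/
noncomputable def conjProdCoeff {i : ℕ} (v : Fin i → ℂ) : Fin (2 * i) → ℝ :=
  fun m ↦ (conjProd v).coeff m

lemma toPolyR_conjProdCoeff {i : ℕ} (v : Fin i → ℂ) :
    toPolyR (2 * i) (conjProdCoeff v) = conjProd v :=
  toPolyR_coeff (monic_conjProd v) (natDegree_conjProd v)

lemma continuous_conjProdCoeff {i : ℕ} : Continuous (conjProdCoeff (i := i)) :=
  continuous_pi fun m ↦ by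
    simp only [conjProdCoeff, conjProd]
    exact continuous_coeff_prod Finset.univ (fun s (v : Fin i → ℂ) ↦ conjQuadratic (v s))
      (fun s m ↦ (continuous_coeff_conjQuadratic m).comp (continuous_apply s)) m

lemma norm_lt_norm_conjProdCoeff {i : ℕ} (v : Fin i → ℂ) (s : Fin i) :
    ‖v s‖ < ‖conjProdCoeff v‖ + 1 := by
  have hm := (monic_conjProd v).map (algebraMap ℝ ℂ)
  have hroot : ((conjProd v).map (algebraMap ℝ ℂ)).IsRoot (v s) := by
    rw [map_conjProd, IsRoot, eval_prod]
    exact Finset.prod_eq_zero (Finset.mem_univ s) (by simp)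
  have hlt : ‖v s‖₊ < ‖conjProdCoeff v‖₊ + 1 := by
    refine (hroot.norm_lt_cauchyBound hm.ne_zero).trans_le ?_
    rw [cauchyBound, hm.leadingCoeff, nnnorm_one, div_one]
    gcongr
    refine Finset.sup_le fun m hm' ↦ ?_
    rw [Finset.mem_range, natDegree_map, natDegree_conjProd] at hm'
    simpa [conjProdCoeff] using! nnnorm_le_pi_nnnorm (conjProdCoeff v) ⟨m, hm'⟩
  exact_mod_cast hlt

lemma isProperMap_conjProdCoeff {i : ℕ} : IsProperMap (conjProdCoeff (i := i)) := by
  refine isProperMap_iff_tendsto_cocompact.2 ⟨continuous_conjProdCoeff,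
    tendsto_cocompact_cocompact_of_norm fun ε ↦ ⟨max ε 0 + 1, fun v hv ↦ ?_⟩⟩
  by_contra! h
  refine hv.not_ge ((pi_norm_le_iff_of_nonneg (by positivity)).2 fun s ↦ ?_)
  have := norm_lt_norm_conjProdCoeff v s
  linarith [le_max_left ε 0]

lemma eval_conjProd_eq_zero_iff {i : ℕ} (v : Fin i → ℂ) (x : ℝ) :
    (conjProd v).eval x = 0 ↔ ∃ s, v s = x := by
  have h : ((conjProd v).map (algebraMap ℝ ℂ)).eval (x : ℂ) = ((conjProd v).eval x : ℝ) := by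
    rw [eval_map_algebraMap]
    exact aeval_algebraMap_apply_eq_algebraMap_eval x _
  rw [← Complex.ofReal_eq_zero, ← h, map_conjProd, eval_prod, Finset.prod_eq_zero_iff]
  simp only [Finset.mem_univ, true_and, eval_mul, eval_sub, eval_X, eval_C, mul_eq_zero,
    sub_eq_zero]
  refine exists_congr fun s ↦ ⟨?_, fun h ↦ Or.inl h.symm⟩
  rintro (h | h)
  · exact h.symm
  · rw [← Complex.conj_conj (v s), ← h, Complex.conj_ofReal]

lemma count_roots_conjProd {i : ℕ} (v : Fin i → ℂ) (hv : ∀ s, 0 < (v s).im) {z : ℂ}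
    (hz : 0 < z.im) :
    ((conjProd v).map (algebraMap ℝ ℂ)).roots.count z = Fintype.card {s // v s = z} := by
  have h0 : ∏ s, (X - C (v s)) * (X - C (conj (v s))) ≠ 0 := by
    rw [← map_conjProd]
    exact ((monic_conjProd v).map _).ne_zero
  rw [map_conjProd, roots_prod _ _ h0, Multiset.count_bind, Fintype.card_subtype,
    Finset.card_filter]
  refine Finset.sum_congr rfl fun s _ ↦ ?_
  rw [roots_mul (mul_ne_zero (X_sub_C_ne_zero _) (X_sub_C_ne_zero _)), roots_X_sub_C,
    roots_X_sub_C, Multiset.count_add, Multiset.count_singleton, Multiset.count_singleton]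
  have h : z ≠ conj (v s) := by
    rintro rfl
    have := hv s
    rw [Complex.conj_im] at hz
    linarith
  simp [h, eq_comm]

lemma exists_perm_of_conjProd_eq {i : ℕ} {v w : Fin i → ℂ} (hv : ∀ s, 0 < (v s).im)
    (hw : ∀ s, 0 < (w s).im) (h : conjProd v = conjProd w) :
    ∃ σ : Equiv.Perm (Fin i), v ∘ σ = w := by
  have hcard (z : ℂ) : Nonempty ({s // w s = z} ≃ {s // v s = z}) := by
    refine Fintype.card_eq.1 ?_
    by_cases hz : 0 < z.im
    · rw [← count_roots_conjProd v hv hz, ← count_roots_conjProd w hw hz, h]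
    · have hv' : IsEmpty {s // v s = z} := ⟨fun s ↦ hz (s.2 ▸ hv s)⟩
      have hw' : IsEmpty {s // w s = z} := ⟨fun s ↦ hz (s.2 ▸ hw s)⟩
      simp
  exact ⟨Equiv.ofFiberEquiv fun z ↦ (hcard z).some, funext (Equiv.ofFiberEquiv_map _)⟩

lemma exists_conjProd_eq {i : ℕ} {p : ℝ[X]} (hp : p.Monic) (hdeg : p.natDegree = 2 * i)
    (hroot : ∀ x, p.eval x ≠ 0) : ∃ v : Fin i → ℂ, (∀ s, 0 < (v s).im) ∧ conjProd v = p := by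
  induction i generalizing p with
  | zero => exact ⟨Fin.elim0, fun s ↦ s.elim0, by simp [conjProd, hp.natDegree_eq_zero.1 hdeg]⟩
  | succ i ih =>
    obtain ⟨z, hz, hz0⟩ : ∃ z : ℂ, 0 < z.im ∧ aeval z p = 0 := by
      obtain ⟨z, hz⟩ := IsAlgClosed.exists_aeval_eq_zero ℂ p
        (natDegree_pos_iff_degree_pos.1 (by lia)).ne'
      rcases lt_trichotomy z.im 0 with h | h | h
      · exact ⟨conj z, by simpa using h, by rw [aeval_conj, hz, map_zero]⟩
      · refine absurd ?_ (hroot z.re)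
        rw [← Complex.ofReal_eq_zero, ← Complex.coe_algebraMap,
          ← aeval_algebraMap_apply_eq_algebraMap_eval, Complex.coe_algebraMap,
          (Complex.ext rfl h.symm : (z.re : ℂ) = z), hz]
      · exact ⟨z, h, hz⟩
    obtain ⟨q, rfl⟩ : conjQuadratic z ∣ p := p.quadratic_dvd_of_aeval_eq_zero_im_ne_zero hz0 hz.ne'
    have hq : q.Monic := (monic_conjQuadratic z).of_mul_monic_left hp
    rw [(monic_conjQuadratic z).natDegree_mul hq, natDegree_conjQuadratic] at hdeg
    obtain ⟨v, hv, rfl⟩ := ih hq (by lia) fun x hx ↦ hroot x (by rw [eval_mul, hx, mul_zero])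
    exact ⟨Fin.cons z v, Fin.cases hz hv, by simp [conjProd, Fin.prod_univ_succ]⟩

/-- The map sending a tuple of points of the open upper half-plane to the coefficients of the real
polynomial with these roots and their conjugates. -/
noncomputable def upperConjProdCoeff (i : ℕ) (v : Fin i → {z : ℂ // 0 < z.im}) :
    {c : Fin (2 * i) → ℝ // ∀ x : ℝ, (toPolyR (2 * i) c).eval x ≠ 0} :=
  ⟨conjProdCoeff fun s ↦ (v s).val, fun x hx ↦ by
    rw [toPolyR_conjProdCoeff, eval_conjProd_eq_zero_iff] at hx
    obtain ⟨s, hs⟩ := hx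
    simpa [hs] using (v s).2⟩

lemma upperConjProdCoeff_eq_iff {i : ℕ} (v w : Fin i → {z : ℂ // 0 < z.im}) :
    upperConjProdCoeff i v = upperConjProdCoeff i w ↔
      ∃ σ : Equiv.Perm (Fin i), v ∘ σ = w := by
  constructor
  · intro h
    have h' : conjProd (fun s ↦ (v s).val) = conjProd fun s ↦ (w s).val := by
      rw [← toPolyR_conjProdCoeff, ← toPolyR_conjProdCoeff]
      exact congrArg (toPolyR (2 * i)) (congrArg Subtype.val h)
    obtain ⟨σ, hσ⟩ := exists_perm_of_conjProd_eq (fun s ↦ (v s).2) (fun s ↦ (w s).2) h'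
    exact ⟨σ, funext fun s ↦ Subtype.ext (congrFun hσ s)⟩
  · rintro ⟨σ, rfl⟩
    refine Subtype.ext (funext fun m ↦ ?_)
    exact congrArg (coeff · m) (conjProd_comp_perm (fun s ↦ (v s).val) σ).symm

lemma surjective_upperConjProdCoeff (i : ℕ) : Function.Surjective (upperConjProdCoeff i) := by
  rintro ⟨c, hc⟩
  obtain ⟨v, hv, h⟩ := exists_conjProd_eq (monic_toPolyR c) (natDegree_toPolyR c) hc
  refine ⟨fun s ↦ ⟨v s, hv s⟩, Subtype.ext (funext fun m ↦ ?_)⟩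
  exact (congrArg (coeff · m) h).trans (coeff_toPolyR c m)

lemma isProperMap_upperConjProdCoeff (i : ℕ) : IsProperMap (upperConjProdCoeff i) := by
  let B : Set (Fin (2 * i) → ℝ) := {c | ∀ x : ℝ, (toPolyR (2 * i) c).eval x ≠ 0}
  let e (v : Fin i → {z : ℂ // 0 < z.im}) : conjProdCoeff ⁻¹' B :=
    ⟨fun s ↦ (v s).val, (upperConjProdCoeff i v).2⟩
  have hemb : IsEmbedding e := by
    refine IsEmbedding.of_comp (f := e) (g := Subtype.val) ?_ continuous_subtype_val ?_
    · exact Continuous.subtype_mk (by fun_prop) _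
    · exact IsEmbedding.piMap fun _ : Fin i ↦ IsEmbedding.subtypeVal
  have hrange : Set.range e = {v | ∀ s, 0 ≤ (v.val s).im} := by
    ext v
    constructor
    · rintro ⟨w, rfl⟩ s
      exact (w s).2.le
    · intro hv
      refine ⟨fun s ↦ ⟨v.val s, (hv s).lt_of_ne fun h ↦ v.2 (v.val s).re ?_⟩, rfl⟩
      rw [toPolyR_conjProdCoeff, eval_conjProd_eq_zero_iff]
      exact ⟨s, Complex.ext rfl h.symm⟩
  have hclosed : IsClosed (Set.range e) := by
    rw [hrange, Set.ofPred_forall]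
    exact isClosed_iInter fun s ↦ isClosed_le continuous_const
      (Complex.continuous_im.comp ((continuous_apply s).comp continuous_subtype_val))
  have h := (isProperMap_conjProdCoeff.restrictPreimage B).comp
    (IsClosedEmbedding.mk hemb hclosed).isProperMap
  have he : B.restrictPreimage conjProdCoeff ∘ e = upperConjProdCoeff i :=
    funext fun v ↦ Subtype.ext rfl
  rwa [he] at h

/-- **Symmetric product description.** For `i ≥ 1`, the map
`(α_1,…,α_i) ↦ ∏_s (z − α_s)(z − conj α_s)` induces a homeomorphism from `SP^i(H₊)` onto the
space of monic real polynomials of degree `2i` with no real roots (as a subspace of `ℝ^{2i}`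
via coefficients). -/
theorem sp_upper_half_homeo (i : ℕ) (hi : 1 ≤ i) :
    ∃ H : Quotient (permSetoid {z : ℂ // 0 < z.im} i) ≃ₜ
        {c : Fin (2 * i) → ℝ // ∀ x : ℝ, (toPolyR (2 * i) c).eval x ≠ 0},
      ∀ v : Fin i → {z : ℂ // 0 < z.im},
        (H (Quotient.mk (permSetoid {z : ℂ // 0 < z.im} i) v)).val = fun m =>
          ((∏ s : Fin i,
              (Polynomial.X - Polynomial.C (v s).val) *
                (Polynomial.X - Polynomial.C (starRingEnd ℂ (v s).val))).coeff m).re := by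
  have hf := isProperMap_upperConjProdCoeff i
  let F : Quotient (permSetoid {z : ℂ // 0 < z.im} i) →
      {c : Fin (2 * i) → ℝ // ∀ x : ℝ, (toPolyR (2 * i) c).eval x ≠ 0} :=
    Quotient.lift (upperConjProdCoeff i) fun v w h ↦ (upperConjProdCoeff_eq_iff v w).2 h
  have hF : IsHomeomorph F := by
    refine isHomeomorph_iff_continuous_isClosedMap_bijective.2
      ⟨hf.continuous.quotient_lift _, ?_, ?_, ?_⟩
    · exact IsClosedMap.of_comp_surjective Quotient.mk_surjective continuous_quotient_mk'
        hf.isClosedMap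
    · rintro ⟨v⟩ ⟨w⟩ h
      exact Quotient.sound ((upperConjProdCoeff_eq_iff v w).1 h)
    · exact Quotient.lift_surjective _ _ (surjective_upperConjProdCoeff i)
  refine ⟨hF.homeomorph F, fun v ↦ funext fun m ↦ ?_⟩
  rw [← map_conjProd, coeff_map]
  rfl
end
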